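/- Fix a positive integer n. A bijective ℤ-linear map g : O₀ → O₀ satisfies −(1/2)·Tr(g(A)·g(B)) = −(1/2)·Tr(A·B) for all A, B ∈ O₀ (i.e., g is an isometry of the lattice O₀) if and only if there exist γ ∈ GL₂(ℚ) with γ O γ⁻¹ = O and a sign ε ∈ {1, −1} such that g(A) = ε·γ A γ⁻¹ for all A ∈ O₀. In other words, the isometry group of the lattice (O₀, −(1/2)Tr(AB)) is {±Ad_γ : γ normalizes O in GL₂(ℚ)}. -/

import Mathlib

/-- The order `O ⊆ M₂(ℚ)`: matrices `[[a, 2b], [2nc, d]]` with `a, b, c, d ∈ ℤ`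
and `a + d` even (described entrywise). -/
def Oset (n : ℕ) : Set (Matrix (Fin 2) (Fin 2) ℚ) :=
  {A | (∃ a : ℤ, A 0 0 = (a : ℚ)) ∧ (∃ b : ℤ, A 0 1 = 2 * (b : ℚ)) ∧
       (∃ c : ℤ, A 1 0 = 2 * (n : ℚ) * (c : ℚ)) ∧ (∃ d : ℤ, A 1 1 = (d : ℚ)) ∧
       (∃ k : ℤ, A 0 0 + A 1 1 = 2 * (k : ℚ))}

/-- The trace-zero part `O₀ = {A ∈ O : Tr A = 0}` as a `ℤ`-submodule of `M₂(ℚ)`,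
a lattice of rank 3. -/
def Ozero (n : ℕ) : Submodule ℤ (Matrix (Fin 2) (Fin 2) ℚ) where
  carrier := {A | A ∈ Oset n ∧ A.trace = 0}
  zero_mem' := by
    exact ⟨⟨⟨0, by simp⟩, ⟨0, by simp⟩, ⟨0, by simp⟩, ⟨0, by simp⟩, ⟨0, by simp⟩⟩, by simp⟩
  add_mem' := by
    rintro A B ⟨⟨⟨a, ha⟩, ⟨b, hb⟩, ⟨c, hc⟩, ⟨d, hd⟩, ⟨k, hk⟩⟩, htr⟩
      ⟨⟨⟨a', ha'⟩, ⟨b', hb'⟩, ⟨c', hc'⟩, ⟨d', hd'⟩, ⟨k', hk'⟩⟩, htr'⟩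
    refine ⟨⟨⟨a + a', ?_⟩, ⟨b + b', ?_⟩, ⟨c + c', ?_⟩, ⟨d + d', ?_⟩, ⟨k + k', ?_⟩⟩, ?_⟩
    · rw [Matrix.add_apply, ha, ha']; push_cast; ring
    · rw [Matrix.add_apply, hb, hb']; push_cast; ring
    · rw [Matrix.add_apply, hc, hc']; push_cast; ring
    · rw [Matrix.add_apply, hd, hd']; push_cast; ring
    · rw [Matrix.add_apply, Matrix.add_apply]; push_cast; linarith [hk, hk']
    · rw [Matrix.trace_add, htr, htr', add_zero]
  smul_mem' := by
    rintro m A ⟨⟨⟨a, ha⟩, ⟨b, hb⟩, ⟨c, hc⟩, ⟨d, hd⟩, ⟨k, hk⟩⟩, htr⟩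
    have hsmul : ∀ i j, (m • A) i j = (m : ℚ) * A i j := by
      intro i j
      simp [Matrix.smul_apply, zsmul_eq_mul]
    refine ⟨⟨⟨m * a, ?_⟩, ⟨m * b, ?_⟩, ⟨m * c, ?_⟩, ⟨m * d, ?_⟩, ⟨m * k, ?_⟩⟩, ?_⟩
    · rw [hsmul, ha]; push_cast; ring
    · rw [hsmul, hb]; push_cast; ring
    · rw [hsmul, hc]; push_cast; ring
    · rw [hsmul, hd]; push_cast; ring
    · rw [hsmul, hsmul]; push_cast; linear_combination (m : ℚ) * hk
    · rw [Matrix.trace_smul, htr, smul_zero]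

/-- For trace-zero `2 × 2` matrices the anticommutator is the scalar `Tr (M N)`. -/
lemma mul_add_mul_comm_of_trace_eq_zero {M N : Matrix (Fin 2) (Fin 2) ℚ}
    (hM : M.trace = 0) (hN : N.trace = 0) :
    M * N + N * M = (M * N).trace • (1 : Matrix (Fin 2) (Fin 2) ℚ) := by
  rw [Matrix.trace_fin_two] at hM hN
  have hM' : M 1 1 = -M 0 0 := by linarith
  have hN' : N 1 1 = -N 0 0 := by linarith
  ext i j
  fin_cases i <;> fin_cases j <;>
    simp [Matrix.mul_apply, Fin.sum_univ_two, Matrix.trace_fin_two, hM', hN'] <;> ring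

/-- A triple satisfying the relations of the standard basis of `Ozero`, including the
orientation `H E = E`, is simultaneously conjugate to the standard one. -/
lemma exists_intertwiner_of_mul_eq {m : ℚ} (hm : m ≠ 0) {H E F : Matrix (Fin 2) (Fin 2) ℚ}
    (tH : H.trace = 0) (hHH : H * H = 1) (hFF : F * F = 0)
    (hHE : H * E = E) (hEH : H * E + E * H = 0) (hHF : H * F + F * H = 0)
    (hEF : E * F + F * E = (4 * m) • (1 : Matrix (Fin 2) (Fin 2) ℚ)) :
    ∃ γ : Matrix (Fin 2) (Fin 2) ℚ, IsUnit γ.det ∧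
      γ * !![1, 0; 0, -1] = H * γ ∧ γ * !![0, 2; 0, 0] = E * γ ∧
      γ * !![0, 0; 2 * m, 0] = F * γ := by
  have hdet : (H - 1).det = 0 := by
    have h00 := congrFun (congrFun hHH 0) 0
    rw [Matrix.trace_fin_two] at tH
    simp only [Matrix.mul_apply, Fin.sum_univ_two, Matrix.one_apply_eq] at h00
    simp only [Matrix.det_fin_two, Matrix.sub_apply, Matrix.one_apply_eq]
    simp
    linear_combination (H 0 0 - 1) * tH - h00
  obtain ⟨v, hv0, hv⟩ := Matrix.exists_mulVec_eq_zero_iff.mpr hdet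
  replace hv : H.mulVec v = v := by
    rwa [Matrix.sub_mulVec, Matrix.one_mulVec, sub_eq_zero] at hv
  have hEv : E.mulVec v = 0 := by
    have h1 : (E * H).mulVec v = E.mulVec v := by rw [← Matrix.mulVec_mulVec, hv]
    have h2 : E * H = -E := by rw [hHE] at hEH; exact (neg_eq_of_add_eq_zero_right hEH).symm
    rw [h2, Matrix.neg_mulVec] at h1
    ext i
    have := congrFun h1 i
    simp only [Pi.neg_apply] at this
    simp only [Pi.zero_apply]
    linarith
  obtain ⟨w, hw⟩ : ∃ w : Fin 2 → ℚ, w = (2 * m)⁻¹ • F.mulVec v := ⟨_, rfl⟩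
  have hFv : F.mulVec v = (2 * m) • w := by
    rw [hw, smul_smul, mul_inv_cancel₀ (by simpa using hm), one_smul]
  have hEw : E.mulVec w = (2 : ℚ) • v := by
    have h1 : (E * F).mulVec v = (4 * m) • v := by
      rw [eq_sub_of_add_eq hEF, Matrix.sub_mulVec, ← Matrix.mulVec_mulVec, hEv,
        Matrix.mulVec_zero, sub_zero, Matrix.smul_mulVec, Matrix.one_mulVec]
    rw [hw, Matrix.mulVec_smul, Matrix.mulVec_mulVec, h1, smul_smul]
    congr 1
    field_simp
    norm_num
  have hFw : F.mulVec w = 0 := by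
    rw [hw, Matrix.mulVec_smul, Matrix.mulVec_mulVec, hFF, Matrix.zero_mulVec, smul_zero]
  have hHw : H.mulVec w = -w := by
    rw [hw, Matrix.mulVec_smul, Matrix.mulVec_mulVec, eq_neg_of_add_eq_zero_left hHF,
      Matrix.neg_mulVec, ← Matrix.mulVec_mulVec, hv, smul_neg]
  have hw0 : w ≠ 0 := by
    rintro rfl
    rw [Matrix.mulVec_zero] at hEw
    exact hv0 ((smul_eq_zero.mp hEw.symm).resolve_left two_ne_zero)
  refine ⟨!![v 0, w 0; v 1, w 1], ?_, ?_, ?_, ?_⟩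
  · rw [isUnit_iff_ne_zero]
    intro hd
    obtain ⟨x, hx0, hx⟩ := Matrix.exists_mulVec_eq_zero_iff.mpr hd
    have hlin : x 0 • v + x 1 • w = 0 := by
      ext i
      have := congrFun hx i
      fin_cases i <;> simp [Matrix.mulVec, dotProduct, Fin.sum_univ_two] at this ⊢ <;> linarith
    have hlin' : x 0 • v - x 1 • w = 0 := by
      have := congrArg H.mulVec hlin
      rwa [Matrix.mulVec_add, Matrix.mulVec_smul, Matrix.mulVec_smul, hv, hHw,
        Matrix.mulVec_zero, smul_neg, ← sub_eq_add_neg] at this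
    have e0 : (2 * x 0) • v = 0 := by
      rw [two_mul, add_smul]
      linear_combination hlin + hlin'
    have e1 : (2 * x 1) • w = 0 := by
      rw [two_mul, add_smul]
      linear_combination hlin - hlin'
    have hx0' : x 0 = 0 := by simpa [hv0] using e0
    have hx1' : x 1 = 0 := by simpa [hw0] using e1
    exact hx0 (by ext i; fin_cases i <;> simp [hx0', hx1'])
  all_goals
    ext i j
    have a1 := congrFun hv i
    have a2 := congrFun hHw i
    have a3 := congrFun hEv i
    have a4 := congrFun hEw i
    have a5 := congrFun hFv i
    have a6 := congrFun hFw i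
    simp only [Matrix.mulVec, dotProduct, Fin.sum_univ_two, Pi.smul_apply, Pi.neg_apply,
      Pi.zero_apply, smul_eq_mul] at a1 a2 a3 a4 a5 a6
    fin_cases i <;> fin_cases j <;> simp [Matrix.mul_apply, Fin.sum_univ_two] at * <;> linarith

/-- A triple satisfying the relations of the standard basis of `Ozero` is, up to a common
sign, simultaneously conjugate to it. -/
lemma exists_intertwiner {m : ℚ} (hm : m ≠ 0) {H E F : Matrix (Fin 2) (Fin 2) ℚ}
    (tH : H.trace = 0) (hHH : H * H = 1) (hEE : E * E = 0) (hFF : F * F = 0)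
    (hHE : H * E + E * H = 0) (hHF : H * F + F * H = 0)
    (hEF : E * F + F * E = (4 * m) • (1 : Matrix (Fin 2) (Fin 2) ℚ)) :
    ∃ (γ : Matrix (Fin 2) (Fin 2) ℚ) (ε : ℚ), IsUnit γ.det ∧ (ε = 1 ∨ ε = -1) ∧
      γ * !![1, 0; 0, -1] = ε • H * γ ∧ γ * !![0, 2; 0, 0] = ε • E * γ ∧
      γ * !![0, 0; 2 * m, 0] = ε • F * γ := by
  have hm4 : 4 * m ≠ 0 := by simpa using hm
  obtain ⟨X, hX⟩ : ∃ X, X = E * F - F * E := ⟨_, rfl⟩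
  have tX : X.trace = 0 := by rw [hX, Matrix.trace_sub, Matrix.trace_mul_comm, sub_self]
  have hHE' : H * E = -(E * H) := eq_neg_of_add_eq_zero_left hHE
  have hHF' : H * F = -(F * H) := eq_neg_of_add_eq_zero_left hHF
  have hXH : X * H = H * X := by
    have h1 : H * (E * F) = E * F * H := by
      rw [← mul_assoc, hHE', neg_mul, mul_assoc, hHF', mul_neg, neg_neg, mul_assoc]
    have h2 : H * (F * E) = F * E * H := by
      rw [← mul_assoc, hHF', neg_mul, mul_assoc, hHE', mul_neg, neg_neg, mul_assoc]
    rw [hX, sub_mul, mul_sub, h1, h2]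
  obtain ⟨l, hl⟩ : ∃ l : ℚ, X = l • H := by
    refine ⟨(X * H).trace / 2, ?_⟩
    have h := mul_add_mul_comm_of_trace_eq_zero tX tH
    rw [← hXH, ← two_smul ℚ] at h
    calc X = (2⁻¹ : ℚ) • ((2 : ℚ) • (X * H)) * H := by
          rw [smul_smul, inv_mul_cancel₀ two_ne_zero, one_smul, mul_assoc, hHH, mul_one]
      _ = _ := by rw [h, smul_smul, smul_mul_assoc, one_mul]; congr 1; ring
  have hEFE : E * F * E = (4 * m) • E := by
    have h := congrArg (· * E) hEF
    simpa [add_mul, mul_assoc, hEE] using h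
  have hlE : l • (H * E) = (4 * m) • E := by
    rw [← smul_mul_assoc, ← hl, hX, sub_mul, hEFE, mul_assoc, hEE, mul_zero, sub_zero]
  have hl2 : l * l = (4 * m) * (4 * m) := by
    have h1 : X * X = ((4 * m) * (4 * m)) • (1 : Matrix (Fin 2) (Fin 2) ℚ) := by
      have hsum := congrArg (fun Y => Y * Y) hEF
      simp only [smul_mul_smul_comm, mul_one] at hsum
      rw [← hsum, hX]
      have e1 : E * F * (F * E) = 0 := by
        rw [mul_assoc, ← mul_assoc F, hFF, zero_mul, mul_zero]
      have e2 : F * E * (E * F) = 0 := by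
        rw [mul_assoc, ← mul_assoc E, hEE, zero_mul, mul_zero]
      simp only [sub_mul, mul_sub, add_mul, mul_add, e1, e2]
      abel
    rw [hl, smul_mul_smul_comm, hHH] at h1
    simpa using congrFun (congrFun h1 0) 0
  rcases mul_self_eq_mul_self_iff.mp hl2 with h | h
  · have hE1 : H * E = E := by
      rw [h] at hlE
      exact smul_right_injective _ hm4 hlE
    obtain ⟨γ, h0, h1, h2, h3⟩ := exists_intertwiner_of_mul_eq hm tH hHH hFF hE1 hHE hHF hEF
    exact ⟨γ, 1, h0, Or.inl rfl, by rwa [one_smul], by rwa [one_smul], by rwa [one_smul]⟩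
  · have hE1 : -H * -E = -E := by
      rw [h] at hlE
      have : (4 * m) • (-H * -E) = (4 * m) • (-E) := by
        rw [neg_mul_neg, smul_neg, ← hlE, neg_smul, neg_neg]
      exact smul_right_injective _ hm4 this
    obtain ⟨γ, h0, h1, h2, h3⟩ := exists_intertwiner_of_mul_eq (H := -H) (E := -E) (F := -F) hm
      (by rw [Matrix.trace_neg, tH, neg_zero]) (by rwa [neg_mul_neg]) (by rwa [neg_mul_neg]) hE1
      (by simpa only [neg_mul_neg] using hHE) (by simpa only [neg_mul_neg] using hHF)
      (by simpa only [neg_mul_neg] using hEF)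
    exact ⟨γ, -1, h0, Or.inr rfl, by rwa [neg_one_smul], by rwa [neg_one_smul],
      by rwa [neg_one_smul]⟩

/-- Coordinates on `Ozero n`. -/
lemma mem_Ozero_iff {n : ℕ} {A : Matrix (Fin 2) (Fin 2) ℚ} :
    A ∈ Ozero n ↔ ∃ a b c : ℤ,
      A = a • !![1, 0; 0, -1] + b • !![0, 2; 0, 0] + c • !![0, 0; 2 * (n : ℚ), 0] := by
  constructor
  · rintro ⟨⟨⟨a, ha⟩, ⟨b, hb⟩, ⟨c, hc⟩, -, -⟩, htr⟩
    rw [Matrix.trace_fin_two] at htr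
    refine ⟨a, b, c, ?_⟩
    ext i j
    fin_cases i <;> fin_cases j <;> simp <;> linarith
  · rintro ⟨a, b, c, rfl⟩
    refine ⟨⟨⟨a, ?_⟩, ⟨b, ?_⟩, ⟨c, ?_⟩, ⟨-a, ?_⟩, ⟨0, ?_⟩⟩, ?_⟩ <;>
      simp [Matrix.trace_fin_two] <;> ring

/-- The order `Oset n` is `ℤ + Ozero n`. -/
lemma mem_Oset_iff {n : ℕ} {A : Matrix (Fin 2) (Fin 2) ℚ} :
    A ∈ Oset n ↔ ∃ k : ℤ, ∃ B ∈ Ozero n, A = (k : ℚ) • 1 + B := by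
  constructor
  · rintro ⟨⟨a, ha⟩, ⟨b, hb⟩, ⟨c, hc⟩, ⟨d, hd⟩, ⟨k, hk⟩⟩
    refine ⟨k, A - (k : ℚ) • 1, ⟨⟨⟨a - k, ?_⟩, ⟨b, ?_⟩, ⟨c, ?_⟩, ⟨d - k, ?_⟩, ⟨0, ?_⟩⟩, ?_⟩,
      by abel⟩ <;> simp [Matrix.trace_fin_two] <;> linarith
  · rintro ⟨k, B, ⟨⟨⟨a, ha⟩, ⟨b, hb⟩, ⟨c, hc⟩, ⟨d, hd⟩, ⟨l, hl⟩⟩, htr⟩, rfl⟩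
    refine ⟨⟨k + a, ?_⟩, ⟨b, ?_⟩, ⟨c, ?_⟩, ⟨k + d, ?_⟩, ⟨k + l, ?_⟩⟩ <;>
      simp <;> linarith

/-- a bijective `ℤ`-linear map `g : O₀ → O₀` is an isometry for the
form `(A, B) ↦ −(1/2)·Tr(AB)` iff `g = ±Ad_γ` for some `γ ∈ GL₂(ℚ)` normalizing `O`. -/
theorem stmt_15 (n : ℕ) (hn : 0 < n)
    (g : Ozero n →ₗ[ℤ] Ozero n) (hg : Function.Bijective g) :
    (∀ A B : Ozero n,
        -(1 / 2 : ℚ) * (((g A : Matrix (Fin 2) (Fin 2) ℚ)) * ((g B : Matrix (Fin 2) (Fin 2) ℚ))).trace =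
        -(1 / 2 : ℚ) * (((A : Matrix (Fin 2) (Fin 2) ℚ)) * ((B : Matrix (Fin 2) (Fin 2) ℚ))).trace) ↔
    ∃ γ : Matrix (Fin 2) (Fin 2) ℚ, IsUnit γ.det ∧
      ((fun X => γ * X * γ⁻¹) '' Oset n = Oset n) ∧
      ∃ ε : ℚ, (ε = 1 ∨ ε = -1) ∧
        ∀ A : Ozero n, (g A : Matrix (Fin 2) (Fin 2) ℚ) =
          ε • (γ * (A : Matrix (Fin 2) (Fin 2) ℚ) * γ⁻¹) := by
  constructor
  · intro hiso
    have hn' : (n : ℚ) ≠ 0 := by exact_mod_cast hn.ne'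
    have htr : ∀ A : Ozero n, (A : Matrix (Fin 2) (Fin 2) ℚ).trace = 0 := fun A => A.2.2
    have hanti : ∀ A B : Ozero n,
        (g A : Matrix (Fin 2) (Fin 2) ℚ) * g B + g B * g A =
          ((A : Matrix (Fin 2) (Fin 2) ℚ) * B).trace • 1 := by
      intro A B
      rw [mul_add_mul_comm_of_trace_eq_zero (htr _) (htr _)]
      congr 1
      linarith [hiso A B]
    have hsq : ∀ A : Ozero n, (g A : Matrix (Fin 2) (Fin 2) ℚ) * g A =
        (((A : Matrix (Fin 2) (Fin 2) ℚ) * A).trace / 2) • 1 := by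
      intro A
      have h := hanti A A
      rw [← two_smul ℚ] at h
      rw [div_eq_inv_mul, mul_smul, ← h, smul_smul, inv_mul_cancel₀ two_ne_zero, one_smul]
    obtain ⟨h, hh⟩ : ∃ h : Ozero n, (h : Matrix (Fin 2) (Fin 2) ℚ) = !![1, 0; 0, -1] :=
      ⟨⟨_, mem_Ozero_iff.mpr ⟨1, 0, 0, by simp⟩⟩, rfl⟩
    obtain ⟨e, he⟩ : ∃ e : Ozero n, (e : Matrix (Fin 2) (Fin 2) ℚ) = !![0, 2; 0, 0] :=
      ⟨⟨_, mem_Ozero_iff.mpr ⟨0, 1, 0, by simp⟩⟩, rfl⟩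
    obtain ⟨f, hf⟩ : ∃ f : Ozero n, (f : Matrix (Fin 2) (Fin 2) ℚ) = !![0, 0; 2 * (n : ℚ), 0] :=
      ⟨⟨_, mem_Ozero_iff.mpr ⟨0, 0, 1, by simp⟩⟩, rfl⟩
    obtain ⟨γ, ε, hγ, hε, h1, h2, h3⟩ := exists_intertwiner (m := n) hn'
      (H := g h) (E := g e) (F := g f) (htr _)
      (by rw [hsq, hh]; norm_num [Matrix.trace_fin_two])
      (by rw [hsq, he]; simp [Matrix.trace_fin_two])
      (by rw [hsq, hf]; simp [Matrix.trace_fin_two])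
      (by rw [hanti, hh, he]; simp [Matrix.trace_fin_two])
      (by rw [hanti, hh, hf]; simp [Matrix.trace_fin_two])
      (by rw [hanti, he, hf]; congr 1; simp [Matrix.trace_fin_two]; ring)
    have hεε : ε * ε = 1 := by rcases hε with rfl | rfl <;> norm_num
    have hint : ∀ A : Ozero n, γ * (A : Matrix (Fin 2) (Fin 2) ℚ) = ε • g A * γ := by
      intro A
      obtain ⟨a, b, c, hA⟩ := mem_Ozero_iff.mp A.2
      have hA' : A = a • h + b • e + c • f := by
        apply Subtype.ext
        simp only [Submodule.coe_add, Submodule.coe_smul_of_tower, hh, he, hf]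
        exact hA
      have hgA : (g A : Matrix (Fin 2) (Fin 2) ℚ) = a • (g h : Matrix (Fin 2) (Fin 2) ℚ)
          + b • (g e : Matrix (Fin 2) (Fin 2) ℚ) + c • (g f : Matrix (Fin 2) (Fin 2) ℚ) := by
        rw [hA']
        simp only [map_add, map_smul, Submodule.coe_add, Submodule.coe_smul_of_tower]
      rw [hA, hgA]
      simp only [mul_add, smul_add, add_mul, mul_smul_comm, h1, h2, h3, smul_mul_assoc,
        smul_comm ε]
    have hconj : ∀ A : Ozero n, γ * (A : Matrix (Fin 2) (Fin 2) ℚ) * γ⁻¹ = ε • g A := by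
      intro A
      rw [hint, Matrix.mul_nonsing_inv_cancel_right _ _ hγ]
    have hscal : ∀ (k : ℚ) (B : Matrix (Fin 2) (Fin 2) ℚ),
        γ * (k • 1 + B) * γ⁻¹ = k • 1 + γ * B * γ⁻¹ := by
      intro k B
      rw [mul_add, add_mul, mul_smul_comm, mul_one, smul_mul_assoc, Matrix.mul_nonsing_inv _ hγ]
    have hεmem : ∀ A ∈ Ozero n, ε • A ∈ Ozero n := by
      intro A hA
      rcases hε with rfl | rfl
      · rwa [one_smul]
      · rw [neg_one_smul]; exact neg_mem hA
    refine ⟨γ, hγ, ?_, ε, hε, ?_⟩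
    · apply Set.Subset.antisymm
      · rintro _ ⟨A, hA, rfl⟩
        obtain ⟨k, B, hB, rfl⟩ := mem_Oset_iff.mp hA
        exact mem_Oset_iff.mpr ⟨k, _, hεmem _ (g ⟨B, hB⟩).2, by
          simp only [hscal]; rw [← hconj ⟨B, hB⟩]⟩
      · intro A hA
        obtain ⟨k, B, hB, rfl⟩ := mem_Oset_iff.mp hA
        obtain ⟨C, hC⟩ := hg.2 ⟨ε • B, hεmem B hB⟩
        refine ⟨(k : ℚ) • 1 + C, mem_Oset_iff.mpr ⟨k, C, C.2, rfl⟩, ?_⟩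
        simp only [hscal, hconj, hC, smul_smul, hεε, one_smul]
    · intro A
      rw [hconj, smul_smul, hεε, one_smul]
  · rintro ⟨γ, hγ, -, ε, hε, h⟩ A B
    have hεε : ε * ε = 1 := by rcases hε with rfl | rfl <;> norm_num
    have hmul : γ * (A : Matrix (Fin 2) (Fin 2) ℚ) * γ⁻¹ * (γ * B * γ⁻¹) = γ * (A * B) * γ⁻¹ := by
      simp only [mul_assoc, Matrix.nonsing_inv_mul_cancel_left _ _ hγ]
    rw [h, h, smul_mul_smul_comm, hεε, one_smul, hmul, Matrix.trace_mul_comm,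
      Matrix.nonsing_inv_mul_cancel_left _ _ hγ]
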